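/- Let K be a field, let d be a natural number, and let F ∈ K[x, y] be a polynomial of total degree at most d whose coefficient of x^d equals 1. Set A = K[x, y]/(F), let A_y denote the localization of A at the image of y, let A' ⊆ A_y be the image of A under the localization map, and let B ⊆ A_y be the K-subalgebra generated by x/y and 1/y. Then the quotient K-vector space A_y / (A' + B) is free with basis the classes of the elements x^i · y^{−j} for 2 ≤ i ≤ d − 1 and 1 ≤ j ≤ i − 1; in particular it has dimension (d − 1)(d − 2)/2 over K. -/

import Mathlib

open MvPolynomial

/-- The coordinate ring `A = K[x, y]/(F)` of the affine plane curve `F = 0`,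
with `x = X 0` and `y = X 1`. -/
abbrev CurveRing {K : Type*} [Field K] (F : MvPolynomial (Fin 2) K) :=
  MvPolynomial (Fin 2) K ⧸ Ideal.span {F}

/-- The image of `x` in `A = K[x, y]/(F)`. -/
noncomputable def curveX {K : Type*} [Field K] (F : MvPolynomial (Fin 2) K) :
    CurveRing F := Ideal.Quotient.mk (Ideal.span {F}) (X 0)

/-- The image of `y` in `A = K[x, y]/(F)`. -/
noncomputable def curveY {K : Type*} [Field K] (F : MvPolynomial (Fin 2) K) :
    CurveRing F := Ideal.Quotient.mk (Ideal.span {F}) (X 1)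

/-- The `K`-subspace `A' + B` of `A_y`, spanned by the image `A'` of `A` under the
localization map together with the `K`-subalgebra `B` generated by `x/y` and `1/y`. -/
noncomputable def oldSubspace {K : Type*} [Field K] (F : MvPolynomial (Fin 2) K)
    (Ay : Type*) [CommRing Ay] [Algebra (CurveRing F) Ay]
    [Algebra K Ay] [IsScalarTower K (CurveRing F) Ay] (invy : Ay) : Submodule K Ay :=
  Submodule.span K (Set.range (algebraMap (CurveRing F) Ay) ∪
    (Algebra.adjoin K {algebraMap (CurveRing F) Ay (curveX F) * invy, invy} :
      Subalgebra K Ay))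

section QuotientBasis

variable {K V ι κ : Type*} [Field K] [AddCommGroup V] [Module K V]

/-- A basis of `V` restricts to a basis of the quotient of `V` by the span of a subfamily, indexed
by the complementary subfamily. -/
theorem exists_basis_quotient_span_image (b : Module.Basis ι K V) (s : Set ι) (e : κ → ι)
    (he : Function.Injective e) (hrange : Set.range e = sᶜ) :
    ∃ c : Module.Basis κ K (V ⧸ Submodule.span K (b '' s)),
      ∀ p, c p = Submodule.Quotient.mk (b (e p)) := by
  have hdisj : Disjoint (Submodule.span K (Set.range (b ∘ e)))
      (LinearMap.ker (Submodule.span K (b '' s)).mkQ) := by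
    rw [Submodule.ker_mkQ, Set.range_comp, hrange]
    exact b.linearIndependent.disjoint_span_image disjoint_compl_left
  have hspan : ⊤ ≤ Submodule.span K
      (Set.range ((Submodule.span K (b '' s)).mkQ ∘ (b ∘ e))) := by
    have hmap : (⊤ : Submodule K (V ⧸ Submodule.span K (b '' s))) =
        Submodule.map (Submodule.span K (b '' s)).mkQ (Submodule.span K (Set.range b)) := by
      rw [b.span_eq, Submodule.map_top, Submodule.range_mkQ]
    rw [hmap, Submodule.map_span, Submodule.span_le]
    rintro _ ⟨_, ⟨i, rfl⟩, rfl⟩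
    by_cases hi : i ∈ s
    · have h0 : (Submodule.span K (b '' s)).mkQ (b i) = 0 := by
        rw [Submodule.mkQ_apply, Submodule.Quotient.mk_eq_zero]
        exact Submodule.subset_span ⟨i, hi, rfl⟩
      rw [h0]
      exact Submodule.zero_mem _
    · have hi' : i ∈ Set.range e := hrange ▸ hi
      obtain ⟨p, rfl⟩ := hi'
      exact Submodule.subset_span ⟨p, rfl⟩
  refine ⟨Module.Basis.mk ((b.linearIndependent.comp e he).map hdisj) hspan, fun p => ?_⟩
  rw [Module.Basis.mk_apply]
  rfl

end QuotientBasis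

section Card

/-- The number of pairs `(i, j)` with `2 ≤ i ≤ d - 1` and `1 ≤ j ≤ i - 1`. -/
theorem natCard_triangle (d : ℕ) :
    Nat.card {p : ℕ × ℕ // 2 ≤ p.1 ∧ p.1 ≤ d - 1 ∧ 1 ≤ p.2 ∧ p.2 ≤ p.1 - 1} =
      (d - 1) * (d - 2) / 2 := by
  let e : {p : ℕ × ℕ // 2 ≤ p.1 ∧ p.1 ≤ d - 1 ∧ 1 ≤ p.2 ∧ p.2 ≤ p.1 - 1} ≃
      (Σ i : Fin (d - 1), Fin i) :=
    { toFun := fun p => ⟨⟨p.1.1 - 1, by have := p.2; omega⟩,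
        ⟨p.1.2 - 1, by have := p.2; simp only; omega⟩⟩
      invFun := fun q => ⟨(q.1 + 1, q.2 + 1), by
        have h1 := q.1.2
        have h2 := q.2.2
        simp only
        omega⟩
      left_inv := by
        rintro ⟨⟨i, j⟩, h⟩
        simp only at h
        simp only [Subtype.mk.injEq, Prod.mk.injEq]
        omega
      right_inv := by
        rintro ⟨⟨i, hi⟩, ⟨j, hj⟩⟩
        rfl }
  rw [Nat.card_congr e, Nat.card_eq_fintype_card, Fintype.card_sigma]
  simp only [Fintype.card_fin]
  rw [Fin.sum_univ_eq_sum_range (fun i => i), Finset.sum_range_id, Nat.sub_sub]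

end Card

section Monomials

variable {K : Type*} [Field K] {d : ℕ} {F : MvPolynomial (Fin 2) K}

theorem exponents_of_mem_support_erase (hdeg : F.totalDegree ≤ d) {s : Fin 2 →₀ ℕ}
    (hs : s ∈ F.support.erase (Finsupp.single 0 d)) : s 0 < d ∧ s 0 + s 1 ≤ d := by
  rw [Finset.mem_erase] at hs
  have hle : s 0 + s 1 ≤ d := by
    have h := (le_totalDegree hs.2).trans hdeg
    rwa [Finsupp.sum_fintype _ _ (fun _ => rfl), Fin.sum_univ_two] at h
  refine ⟨lt_of_le_of_ne (by omega) fun h0 => hs.1 ?_, hle⟩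
  ext i
  fin_cases i
  · simpa using h0
  · have : s 1 = 0 := by omega
    simpa using this

theorem aeval_eq_sum_smul {S : Type*} [CommRing S] [Algebra K S] (v : Fin 2 → S)
    (P : MvPolynomial (Fin 2) K) :
    aeval v P = ∑ s ∈ P.support, P.coeff s • (v 0 ^ s 0 * v 1 ^ s 1) := by
  rw [aeval_def, eval₂_eq']
  refine Finset.sum_congr rfl fun s _ => ?_
  rw [Fin.prod_univ_two, Algebra.smul_def]

theorem aeval_eq_pow_add_sum (hmonic : F.coeff (Finsupp.single (0 : Fin 2) d) = 1)
    {S : Type*} [CommRing S] [Algebra K S] (v : Fin 2 → S) :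
    aeval v F = v 0 ^ d +
      ∑ s ∈ F.support.erase (Finsupp.single 0 d), F.coeff s • (v 0 ^ s 0 * v 1 ^ s 1) := by
  have hmem : Finsupp.single (0 : Fin 2) d ∈ F.support := by
    rw [mem_support_iff, hmonic]
    exact one_ne_zero
  rw [aeval_eq_sum_smul, ← Finset.add_sum_erase _ _ hmem, hmonic]
  simp

/-- Reduction modulo a monic relation `F(x, u) = 0`: a subspace which contains the monomials
`x ^ n * u ^ k` with `n < d` whose exponents satisfy `Q` contains all monomials whose exponents
satisfy `Q`, as soon as `Q` is stable under replacing `x ^ d` by the other monomials of `F`. -/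
theorem pow_mul_zpow_mem (hdeg : F.totalDegree ≤ d)
    (hmonic : F.coeff (Finsupp.single (0 : Fin 2) d) = 1)
    {S : Type*} [CommRing S] [Algebra K S] (x : S) (u : Sˣ)
    (hF : aeval ![x, (u : S)] F = 0) (W : Submodule K S) (Q : ℕ → ℤ → Prop)
    (hQ : ∀ (n : ℕ) (k : ℤ) (a b : ℕ), a < d → a + b ≤ d → Q (n + d) k → Q (n + a) (k + b))
    (hW : ∀ (n : ℕ) (k : ℤ), n < d → Q n k → x ^ n * ((u ^ k : Sˣ) : S) ∈ W) (n : ℕ) :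
    ∀ k : ℤ, Q n k → x ^ n * ((u ^ k : Sˣ) : S) ∈ W := by
  induction n using Nat.strong_induction_on with
  | _ n ih =>
    intro k hk
    by_cases hn : n < d
    · exact hW n k hn hk
    · obtain ⟨m, rfl⟩ : ∃ m, n = m + d := ⟨n - d, by omega⟩
      rw [aeval_eq_pow_add_sum hmonic] at hF
      have hx := eq_neg_of_add_eq_zero_left hF
      simp only [Matrix.cons_val_zero, Matrix.cons_val_one] at hx
      rw [pow_add, hx, mul_neg, neg_mul, Finset.mul_sum, Finset.sum_mul]
      refine W.neg_mem (W.sum_mem fun s hs => ?_)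
      obtain ⟨h0, h1⟩ := exponents_of_mem_support_erase hdeg hs
      have hterm : x ^ m * F.coeff s • (x ^ s 0 * (u : S) ^ s 1) * ((u ^ k : Sˣ) : S) =
          F.coeff s • (x ^ (m + s 0) * ((u ^ (k + (s 1 : ℤ)) : Sˣ) : S)) := by
        rw [zpow_add, zpow_natCast, Units.val_mul, Units.val_pow_eq_pow_val, mul_smul_comm,
          smul_mul_assoc, pow_add]
        congr 1
        ring
      rw [hterm]
      exact W.smul_mem _ (ih _ (by omega) _ (hQ m k _ _ h0 h1 hk))

end Monomials

section LaurentModel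

variable {K : Type*} [Field K]

theorem val_zpow_eq_map_T {S : Type*} [CommRing S] (g : LaurentPolynomial K →+* S) (u : Sˣ)
    (hu : (u : S) = g (LaurentPolynomial.T 1)) (k : ℤ) :
    ((u ^ k : Sˣ) : S) = g (LaurentPolynomial.T k) := by
  have hinv : ((u⁻¹ : Sˣ) : S) = g (LaurentPolynomial.T (-1)) := by
    refine Units.inv_eq_of_mul_eq_one_right ?_
    rw [hu, ← map_mul, ← LaurentPolynomial.T_add, add_neg_cancel, LaurentPolynomial.T_zero, map_one]
  induction k using Int.induction_on with
  | zero => simp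
  | succ n ih => rw [zpow_add, zpow_one, Units.val_mul, ih, hu, ← map_mul, LaurentPolynomial.T_add]
  | pred n ih =>
    rw [zpow_sub, zpow_one, Units.val_mul, ih, hinv, ← map_mul, LaurentPolynomial.T_sub]

/-- The polynomial `F(X, T)` over the Laurent polynomial ring `K[T, T⁻¹]`. -/
noncomputable def laurentCurve (F : MvPolynomial (Fin 2) K) :
    Polynomial (LaurentPolynomial K) :=
  aeval ![Polynomial.X, Polynomial.C (LaurentPolynomial.T 1)] F

variable {d : ℕ} {F : MvPolynomial (Fin 2) K}

theorem exists_laurentCurve_eq (hdeg : F.totalDegree ≤ d)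
    (hmonic : F.coeff (Finsupp.single (0 : Fin 2) d) = 1) :
    ∃ g : Polynomial (LaurentPolynomial K), g.degree < d ∧
      laurentCurve F = Polynomial.X ^ d + g := by
  refine ⟨_, ?_, aeval_eq_pow_add_sum hmonic _⟩
  rw [← Polynomial.mem_degreeLT]
  refine Submodule.sum_mem _ fun s hs => ?_
  obtain ⟨h0, -⟩ := exponents_of_mem_support_erase hdeg hs
  rw [Polynomial.mem_degreeLT, Algebra.smul_def, IsScalarTower.algebraMap_apply K
    (LaurentPolynomial K) (Polynomial (LaurentPolynomial K)), Polynomial.algebraMap_eq]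
  simp only [Matrix.cons_val_zero, Matrix.cons_val_one]
  rw [← Polynomial.C_pow, mul_left_comm, ← Polynomial.C_mul, mul_comm]
  exact (Polynomial.degree_C_mul_X_pow_le _ _).trans_lt (by exact_mod_cast h0)

theorem laurentCurve_monic (hdeg : F.totalDegree ≤ d)
    (hmonic : F.coeff (Finsupp.single (0 : Fin 2) d) = 1) : (laurentCurve F).Monic := by
  obtain ⟨g, hg, h⟩ := exists_laurentCurve_eq hdeg hmonic
  exact h ▸ Polynomial.monic_X_pow_add hg

theorem laurentCurve_natDegree (hdeg : F.totalDegree ≤ d)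
    (hmonic : F.coeff (Finsupp.single (0 : Fin 2) d) = 1) : (laurentCurve F).natDegree = d := by
  obtain ⟨g, hg, h⟩ := exists_laurentCurve_eq hdeg hmonic
  rw [h]
  refine Polynomial.natDegree_eq_of_degree_eq_some ?_
  rw [Polynomial.degree_add_eq_left_of_degree_lt (by rwa [Polynomial.degree_X_pow]),
    Polynomial.degree_X_pow]

theorem linearIndependent_root_pow_mul_T (hdeg : F.totalDegree ≤ d)
    (hmonic : F.coeff (Finsupp.single (0 : Fin 2) d) = 1) :
    LinearIndependent K (fun p : Fin d × ℤ => AdjoinRoot.root (laurentCurve F) ^ (p.1 : ℕ) *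
      AdjoinRoot.of (laurentCurve F) (LaurentPolynomial.T p.2)) := by
  have hm := laurentCurve_monic hdeg hmonic
  have hdim : d = (AdjoinRoot.powerBasis' hm).dim := by
    rw [AdjoinRoot.powerBasis'_dim, laurentCurve_natDegree hdeg hmonic]
  let b := (AddMonoidAlgebra.basis ℤ K).smulTower (AdjoinRoot.powerBasis' hm).basis
  have hli := b.linearIndependent.comp
    (fun p : Fin d × ℤ => (p.2, Fin.cast hdim p.1)) fun p q hpq => by
      simp only [Prod.mk.injEq, Fin.cast_inj] at hpq
      exact Prod.ext hpq.2 hpq.1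
  convert hli using 1
  funext p
  simp only [Function.comp_apply, b, Module.Basis.smulTower_apply, PowerBasis.basis_eq_pow,
    AdjoinRoot.powerBasis'_gen, Fin.val_cast, Algebra.smul_def, AdjoinRoot.algebraMap_eq]
  rw [mul_comm]
  congr 2

end LaurentModel

section Localization

variable {K : Type*} [Field K] {d : ℕ} {F : MvPolynomial (Fin 2) K}
  {Ay : Type*} [CommRing Ay] [Algebra (CurveRing F) Ay] [Algebra K Ay]
  [IsScalarTower K (CurveRing F) Ay]

theorem algebraMap_mk_eq_aeval (P : MvPolynomial (Fin 2) K) :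
    algebraMap (CurveRing F) Ay (Ideal.Quotient.mk _ P) =
      aeval ![algebraMap (CurveRing F) Ay (curveX F), algebraMap (CurveRing F) Ay (curveY F)] P := by
  have h : ((IsScalarTower.toAlgHom K (CurveRing F) Ay).comp
      (Ideal.Quotient.mkₐ K (Ideal.span {F}))) =
      aeval ![algebraMap (CurveRing F) Ay (curveX F),
        algebraMap (CurveRing F) Ay (curveY F)] := by
    ext i
    fin_cases i <;> simp [curveX, curveY]
  exact DFunLike.congr_fun h P

theorem oldSubspace_eq_span (hdeg : F.totalDegree ≤ d)
    (hmonic : F.coeff (Finsupp.single (0 : Fin 2) d) = 1)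
    (u : Ayˣ) (hu : (u : Ay) = algebraMap (CurveRing F) Ay (curveY F)) :
    oldSubspace F Ay ((u⁻¹ : Ayˣ) : Ay) = Submodule.span K ((fun p : Fin d × ℤ =>
      algebraMap (CurveRing F) Ay (curveX F) ^ (p.1 : ℕ) * ((u ^ p.2 : Ayˣ) : Ay)) ''
        {p | 0 ≤ p.2 ∨ (p.1 : ℤ) + p.2 ≤ 0}) := by
  have hF : aeval ![algebraMap (CurveRing F) Ay (curveX F), (u : Ay)] F = 0 := by
    rw [hu, ← algebraMap_mk_eq_aeval, Ideal.Quotient.mk_singleton_self, map_zero]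
  have hmon (m n : ℕ) : (algebraMap (CurveRing F) Ay (curveX F) * ((u⁻¹ : Ayˣ) : Ay)) ^ m *
      ((u⁻¹ : Ayˣ) : Ay) ^ n = algebraMap (CurveRing F) Ay (curveX F) ^ m *
        ((u ^ (-((m : ℤ) + n)) : Ayˣ) : Ay) := by
    rw [mul_pow, mul_assoc, ← pow_add, ← Units.val_pow_eq_pow_val, zpow_neg, ← Nat.cast_add,
      zpow_natCast, inv_pow]
  apply le_antisymm
  · refine Submodule.span_le.2 (Set.union_subset ?_ ?_)
    · rintro _ ⟨a, rfl⟩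
      obtain ⟨P, rfl⟩ := Ideal.Quotient.mk_surjective a
      rw [algebraMap_mk_eq_aeval, ← hu, aeval_eq_sum_smul]
      refine Submodule.sum_mem _ fun s _ => Submodule.smul_mem _ _ ?_
      simp only [Matrix.cons_val_zero, Matrix.cons_val_one]
      rw [← Units.val_pow_eq_pow_val, ← zpow_natCast]
      refine pow_mul_zpow_mem hdeg hmonic _ u hF _ (fun _ k => 0 ≤ k)
        (fun _ _ _ _ _ _ _ => by omega)
        (fun m k hm hk => ?_) _ _ (by omega)
      exact Submodule.subset_span ⟨(⟨m, hm⟩, k), Or.inl hk, rfl⟩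
    · rw [← Subalgebra.coe_toSubmodule, Algebra.adjoin_eq_span, SetLike.coe_subset_coe,
        Submodule.span_le]
      intro z hz
      obtain ⟨m, n, rfl⟩ := (Submonoid.mem_closure_pair _ _ _).1 hz
      rw [hmon]
      refine pow_mul_zpow_mem hdeg hmonic _ u hF _ (fun n k => (n : ℤ) + k ≤ 0)
        (fun _ _ _ _ _ _ _ => by push_cast at *; omega)
        (fun m k hm hk => ?_) _ _ (by omega)
      exact Submodule.subset_span ⟨(⟨m, hm⟩, k), Or.inr hk, rfl⟩
  · refine Submodule.span_le.2 ?_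
    rintro _ ⟨⟨i, k⟩, hk | hk, rfl⟩
    · obtain ⟨n, rfl⟩ := Int.eq_ofNat_of_zero_le hk
      refine Submodule.subset_span (Or.inl ⟨curveX F ^ (i : ℕ) * curveY F ^ n, ?_⟩)
      simp [hu]
    · obtain ⟨n, hn⟩ : ∃ n : ℕ, k = -(((i : ℕ) : ℤ) + n) :=
        ⟨(-(i + k : ℤ)).toNat, by simp only at hk; omega⟩
      refine Submodule.subset_span (Or.inr ?_)
      simp only [hn]
      rw [← hmon]
      exact mul_mem (pow_mem (Algebra.subset_adjoin (by simp)) _)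
        (pow_mem (Algebra.subset_adjoin (by simp)) _)

variable [IsLocalization.Away (curveY F) Ay]

theorem linearIndependent_pow_mul_zpow (hdeg : F.totalDegree ≤ d)
    (hmonic : F.coeff (Finsupp.single (0 : Fin 2) d) = 1)
    (u : Ayˣ) (hu : (u : Ay) = algebraMap (CurveRing F) Ay (curveY F)) :
    LinearIndependent K (fun p : Fin d × ℤ =>
      algebraMap (CurveRing F) Ay (curveX F) ^ (p.1 : ℕ) * ((u ^ p.2 : Ayˣ) : Ay)) := by
  let toModel : MvPolynomial (Fin 2) K →ₐ[K] AdjoinRoot (laurentCurve F) :=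
    aeval ![AdjoinRoot.root _, AdjoinRoot.of _ (LaurentPolynomial.T 1)]
  have hmodel : toModel F = 0 := by
    have h : toModel = ((AdjoinRoot.mkₐ (laurentCurve F)).restrictScalars K).comp
        (aeval ![Polynomial.X, Polynomial.C (LaurentPolynomial.T 1)]) := by
      ext i
      fin_cases i <;> simp [toModel]
    rw [h]
    exact AdjoinRoot.mk_self
  let g : CurveRing F →ₐ[K] AdjoinRoot (laurentCurve F) :=
    Ideal.Quotient.liftₐ _ toModel fun a ha => by
      obtain ⟨c, rfl⟩ := Ideal.mem_span_singleton'.1 ha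
      rw [map_mul, hmodel, mul_zero]
  have hgx : g (curveX F) = AdjoinRoot.root _ := by
    exact (Ideal.Quotient.lift_mk _ _ _).trans (by simp [toModel])
  have hgy : g (curveY F) = AdjoinRoot.of _ (LaurentPolynomial.T 1) := by
    exact (Ideal.Quotient.lift_mk _ _ _).trans (by simp [toModel])
  have hunit : ∀ y : Submonoid.powers (curveY F), IsUnit (g y) := by
    rintro ⟨_, n, rfl⟩
    simp only [map_pow, hgy]
    exact ((LaurentPolynomial.isUnit_T 1).map _).pow n
  let φ : Ay →ₐ[K] AdjoinRoot (laurentCurve F) := IsLocalization.liftAlgHom hunit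
  have hφ (a : CurveRing F) : φ (algebraMap _ Ay a) = g a := by
    rw [IsLocalization.liftAlgHom_apply]
    exact IsLocalization.lift_eq _ a
  refine LinearIndependent.of_comp φ.toLinearMap ?_
  convert linearIndependent_root_pow_mul_T hdeg hmonic using 1
  funext p
  have hz := val_zpow_eq_map_T (AdjoinRoot.of (laurentCurve F))
    (Units.map (φ : Ay →* AdjoinRoot (laurentCurve F)) u) (by simp [hu, hφ, hgy]) p.2
  rw [← hz, ← map_zpow, Units.coe_map]
  simp [hφ, hgx]

theorem span_pow_mul_zpow_eq_top (hdeg : F.totalDegree ≤ d)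
    (hmonic : F.coeff (Finsupp.single (0 : Fin 2) d) = 1)
    (u : Ayˣ) (hu : (u : Ay) = algebraMap (CurveRing F) Ay (curveY F)) :
    ⊤ ≤ Submodule.span K (Set.range (fun p : Fin d × ℤ =>
      algebraMap (CurveRing F) Ay (curveX F) ^ (p.1 : ℕ) * ((u ^ p.2 : Ayˣ) : Ay))) := by
  have hF : aeval ![algebraMap (CurveRing F) Ay (curveX F), (u : Ay)] F = 0 := by
    rw [hu, ← algebraMap_mk_eq_aeval, Ideal.Quotient.mk_singleton_self, map_zero]
  intro z _
  obtain ⟨n, a, hz⟩ := IsLocalization.Away.surj (curveY F) z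
  obtain ⟨P, rfl⟩ := Ideal.Quotient.mk_surjective a
  rw [algebraMap_mk_eq_aeval, ← hu] at hz
  have hz' : z = aeval ![algebraMap (CurveRing F) Ay (curveX F), (u : Ay)] P *
      ((u ^ (-(n : ℤ)) : Ayˣ) : Ay) := by
    rw [← hz, mul_assoc, ← Units.val_pow_eq_pow_val, ← Units.val_mul, zpow_neg, zpow_natCast,
      mul_inv_cancel, Units.val_one, mul_one]
  rw [hz', aeval_eq_sum_smul, Finset.sum_mul]
  refine Submodule.sum_mem _ fun s _ => ?_
  rw [smul_mul_assoc]
  refine Submodule.smul_mem _ _ ?_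
  simp only [Matrix.cons_val_zero, Matrix.cons_val_one]
  rw [mul_assoc, ← Units.val_pow_eq_pow_val, ← Units.val_mul, ← zpow_natCast, ← zpow_add]
  refine pow_mul_zpow_mem hdeg hmonic _ u hF _ (fun _ _ => True) (fun _ _ _ _ _ _ _ => trivial)
    (fun m k hm _ => ?_) _ _ trivial
  exact Submodule.subset_span ⟨(⟨m, hm⟩, k), rfl⟩

end Localization

/-- Let `F ∈ K[x, y]` have total degree at most `d` and coefficient `1` on `x^d`,
let `A = K[x, y]/(F)`, let `A_y` be the localization of `A` away from `y`, let
`A'` be the image of `A` in `A_y` and `B ⊆ A_y` the `K`-subalgebra generated by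
`x/y` and `1/y`. Then the quotient `K`-vector space `A_y / (A' + B)` is free with
basis the classes of `x^i·y^{-j}` for `2 ≤ i ≤ d - 1`, `1 ≤ j ≤ i - 1`; in
particular it has dimension `(d - 1)(d - 2)/2` over `K`. -/
theorem stmt10 {K : Type*} [Field K] (d : ℕ) (F : MvPolynomial (Fin 2) K)
    (hdeg : F.totalDegree ≤ d)
    (hmonic : F.coeff (Finsupp.single (0 : Fin 2) d) = 1)
    (Ay : Type*) [CommRing Ay] [Algebra (CurveRing F) Ay]
    [IsLocalization.Away (curveY F) Ay]
    [Algebra K Ay] [IsScalarTower K (CurveRing F) Ay]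
    (invy : Ay) (hinvy : algebraMap (CurveRing F) Ay (curveY F) * invy = 1) :
    ∃ b : Module.Basis {p : ℕ × ℕ // 2 ≤ p.1 ∧ p.1 ≤ d - 1 ∧ 1 ≤ p.2 ∧ p.2 ≤ p.1 - 1} K
        (Ay ⧸ oldSubspace F Ay invy),
      (∀ p, b p = Submodule.Quotient.mk
        ((algebraMap (CurveRing F) Ay (curveX F)) ^ p.1.1 * invy ^ p.1.2)) ∧
      Module.finrank K (Ay ⧸ oldSubspace F Ay invy) = (d - 1) * (d - 2) / 2 := by
  let u : Ayˣ := ⟨algebraMap (CurveRing F) Ay (curveY F), invy, hinvy, by rw [mul_comm, hinvy]⟩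
  let mono : Module.Basis (Fin d × ℤ) K Ay := Module.Basis.mk
    (linearIndependent_pow_mul_zpow hdeg hmonic u rfl) (span_pow_mul_zpow_eq_top hdeg hmonic u rfl)
  have hold : oldSubspace F Ay invy =
      Submodule.span K (mono '' {p | 0 ≤ p.2 ∨ (p.1 : ℤ) + p.2 ≤ 0}) := by
    rw [Module.Basis.coe_mk]
    exact oldSubspace_eq_span hdeg hmonic u rfl
  let e : {p : ℕ × ℕ // 2 ≤ p.1 ∧ p.1 ≤ d - 1 ∧ 1 ≤ p.2 ∧ p.2 ≤ p.1 - 1} → Fin d × ℤ :=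
    fun p => (⟨p.1.1, by have := p.2; omega⟩, -(p.1.2 : ℤ))
  have he : Function.Injective e := by
    rintro ⟨⟨i, j⟩, h⟩ ⟨⟨i', j'⟩, h'⟩ heq
    simp only [e, Prod.mk.injEq, Fin.mk.injEq] at heq
    simp only [Subtype.mk.injEq, Prod.mk.injEq]
    omega
  have hrange : Set.range e = {p : Fin d × ℤ | 0 ≤ p.2 ∨ (p.1 : ℤ) + p.2 ≤ 0}ᶜ := by
    ext ⟨⟨i, hi⟩, k⟩
    simp only [Set.mem_range, Set.mem_compl_iff, Set.mem_ofPred_eq, not_or, not_le]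
    constructor
    · rintro ⟨⟨⟨i', j⟩, h⟩, heq⟩
      simp only [e, Prod.mk.injEq, Fin.mk.injEq] at heq h
      omega
    · rintro ⟨h1, h2⟩
      refine ⟨⟨(i, (-k).toNat), by simp only; omega⟩, ?_⟩
      simp only [e, Prod.mk.injEq, true_and]
      omega
  obtain ⟨b, hb⟩ := exists_basis_quotient_span_image mono _ e he hrange
  rw [hold]
  refine ⟨b, fun p => ?_, ?_⟩
  · rw [hb, Module.Basis.mk_apply]
    simp only [e, zpow_neg, zpow_natCast, ← inv_pow, Units.val_pow_eq_pow_val]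
    rfl
  · rw [Module.finrank_eq_nat_card_basis b, natCard_triangle]
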